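/- Let G and H be right-angled Artin groups with G one-ended. Let G ↷ (X,μ) and H ↷ (Y,ν) be free ergodic measure-preserving actions on standard probability spaces, and assume there is a stable orbit equivalence f : U → V between them with compression constant κ(f) ≥ 1. Assume G ↷ X is irreducible, with S a standard generating set of G (given by an isomorphism G ≅ G_Γ) all of whose elements act ergodically on X, and let c : G × X → H be an SOE cocycle associated to f. If c is cohomologous to a cocycle c′ such that for some s ∈ S the map x ↦ c′(s,x) is a.e. constant, then κ(f) = 1, c is cohomologous to the cocycle (g,x) ↦ α(g) for some group isomorphism α : G → H, and the actions G ↷ X and H ↷ Y are conjugate through α. -/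

import Mathlib

open MeasureTheory
open scoped ENNReal Pointwise symmDiff

namespace OEPaper

/- ## Right-angled Artin groups and graph combinatorics -/

/-- The commutation relations defining the right-angled Artin group of a graph. -/
def raagRels {V : Type} (Γ : SimpleGraph V) : Set (FreeGroup V) :=
  {r | ∃ u v : V, Γ.Adj u v ∧
    r = FreeGroup.of u * FreeGroup.of v * (FreeGroup.of u)⁻¹ * (FreeGroup.of v)⁻¹}

/-- The right-angled Artin group of a simple graph `Γ`. -/
abbrev RAAG {V : Type} (Γ : SimpleGraph V) : Type := PresentedGroup (raagRels Γ)

/-- The standard generator of `RAAG Γ` associated to a vertex. -/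
def gen {V : Type} (Γ : SimpleGraph V) (v : V) : RAAG Γ := PresentedGroup.of v

/-- The standard subgroup associated to (the full subgraph spanned by) a set of vertices. -/
def standardSub {V : Type} (Γ : SimpleGraph V) (S : Set V) : Subgroup (RAAG Γ) :=
  Subgroup.closure (gen Γ '' S)

/-- Conjugate of a subgroup. -/
def conjSub {G : Type} [Group G] (g : G) (P : Subgroup G) : Subgroup G :=
  Subgroup.map (MulAut.conj g).toMonoidHom P

/-- Parabolic subgroups: conjugates of standard subgroups. -/
def IsParabolic {V : Type} (Γ : SimpleGraph V) (P : Subgroup (RAAG Γ)) : Prop :=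
  ∃ (g : RAAG Γ) (S : Set V), P = conjSub g (standardSub Γ S)

/-- The "orthogonal" of a set of vertices: vertices outside `S` adjacent to every vertex of `S`. -/
def perp {V : Type} (Γ : SimpleGraph V) (S : Set V) : Set V :=
  {v : V | v ∉ S ∧ ∀ u ∈ S, Γ.Adj v u}

/-- `S` spans a join subgraph of `Γ`. -/
def IsJoin {V : Type} (Γ : SimpleGraph V) (S : Set V) : Prop :=
  ∃ S₁ S₂ : Set V, S₁.Nonempty ∧ S₂.Nonempty ∧ S₁ ∪ S₂ = S ∧ ∀ u ∈ S₁, ∀ v ∈ S₂, Γ.Adj u v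

/-- `S` spans a maximal join subgraph of `Γ`. -/
def IsMaxJoin {V : Type} (Γ : SimpleGraph V) (S : Set V) : Prop :=
  IsJoin Γ S ∧ ∀ T : Set V, IsJoin Γ T → S ⊆ T → S = T

/-- Join parabolic subgroups. -/
def IsJoinParabolic {V : Type} (Γ : SimpleGraph V) (P : Subgroup (RAAG Γ)) : Prop :=
  ∃ (g : RAAG Γ) (S : Set V), IsJoin Γ S ∧ P = conjSub g (standardSub Γ S)

/-- Maximal join parabolic subgroups. -/
def IsMaxJoinParabolic {V : Type} (Γ : SimpleGraph V) (P : Subgroup (RAAG Γ)) : Prop :=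
  ∃ (g : RAAG Γ) (S : Set V), IsMaxJoin Γ S ∧ P = conjSub g (standardSub Γ S)

/-- The center of a subgroup `P`, as a subset of the ambient group. -/
def subCenter {G : Type} [Group G] (P : Subgroup G) : Set G :=
  {x : G | x ∈ P ∧ ∀ y ∈ P, x * y = y * x}

/-- The commutation graph of a subset `S` of a group. -/
def chainCommGraph {G : Type} [Group G] (S : Set G) : SimpleGraph S :=
  SimpleGraph.fromRel fun a b => Commute (a : G) (b : G)

/-- A generating set is chain-commuting if its commutation graph is connected. -/
def IsChainCommuting {G : Type} [Group G] (S : Set G) : Prop :=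
  (chainCommGraph S).Connected

/-- Amenability: existence of a finitely additive left-invariant probability
measure defined on all subsets. -/
def IsAmenable (G : Type) [Group G] : Prop :=
  ∃ m : Set G → ℝ, m Set.univ = 1 ∧ (∀ A : Set G, 0 ≤ m A) ∧
    (∀ A B : Set G, Disjoint A B → m (A ∪ B) = m A + m B) ∧
    ∀ (g : G) (A : Set G), m ((g * ·) '' A) = m A

/-- ICC groups: every nontrivial element has an infinite conjugacy class. -/
def IsICC (G : Type) [Group G] : Prop :=
  ∀ g : G, g ≠ 1 → {h : G | ∃ c : G, c * g * c⁻¹ = h}.Infinite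

/-- The root-conjugation property. -/
def RootConjugationProperty (H : Type) [Group H] : Prop :=
  ∀ (h₁ h₂ : H) (k : ℕ), 0 < k → Commute h₁ (h₂ ^ k) → Commute h₁ h₂

/- ## Measured dynamics -/

/-- Measure-preserving action by measurable automorphisms. -/
def PmpAction (G : Type) [Group G] (X : Type) [MeasurableSpace X] [MulAction G X]
    (μ : Measure X) : Prop :=
  ∀ g : G, MeasurePreserving (fun x : X => g • x) μ μ

/-- Essentially free action. -/
def FreeAction (G : Type) [Group G] (X : Type) [MeasurableSpace X] [MulAction G X]
    (μ : Measure X) : Prop :=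
  ∀ g : G, g ≠ 1 → μ {x : X | g • x = x} = 0

/-- Ergodic action of a group. -/
def ErgodicAction (G : Type) [Group G] (X : Type) [MeasurableSpace X] [MulAction G X]
    (μ : Measure X) : Prop :=
  ∀ A : Set X, MeasurableSet A → (∀ g : G, (fun x : X => g • x) ⁻¹' A = A) →
    μ A = 0 ∨ μ A = 1

/-- Ergodicity of the action of a subgroup. -/
def ErgodicSubgroup (G : Type) [Group G] (A : Subgroup G) (X : Type) [MeasurableSpace X]
    [MulAction G X] (μ : Measure X) : Prop :=
  ∀ s : Set X, MeasurableSet s → (∀ a ∈ A, (fun x : X => a • x) ⁻¹' s = s) →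
    μ s = 0 ∨ μ s = 1

/-- Irreducible action of a right-angled Artin group: for some identification of the group
with a `RAAG Δ`, every standard generator acts ergodically. -/
def IrreducibleAction (G : Type) [Group G] (X : Type) [MeasurableSpace X] [MulAction G X]
    (μ : Measure X) : Prop :=
  ∃ (n : ℕ) (Δ : SimpleGraph (Fin n)) (e : RAAG Δ ≃* G),
    ∀ v : Fin n, Ergodic (fun x : X => e (gen Δ v) • x) μ

/-- A measure space isomorphism (mod null sets): a measurable measure-preserving map
admitting an a.e. two-sided measurable inverse. -/
def MeasIso {A : Type} {B : Type} [MeasurableSpace A] [MeasurableSpace B]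
    (μ : Measure A) (ν : Measure B) (F : A → B) : Prop :=
  Measurable F ∧ MeasurePreserving F μ ν ∧
    ∃ F' : B → A, Measurable F' ∧ (∀ᵐ a ∂μ, F' (F a) = a) ∧ ∀ᵐ b ∂ν, F (F' b) = b

/-- Conjugacy of two actions through a given group isomorphism. -/
def ConjugateVia (G : Type) [Group G] (X : Type) [MeasurableSpace X] [MulAction G X]
    (H : Type) [Group H] (Y : Type) [MeasurableSpace Y] [MulAction H Y]
    (μ : Measure X) (ν : Measure Y) (α : G ≃* H) : Prop :=
  ∃ F : X → Y, MeasIso μ ν F ∧ ∀ g : G, ∀ᵐ x ∂μ, F (g • x) = α g • F x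

/-- Conjugacy of two actions. -/
def ConjugateActions (G : Type) [Group G] (X : Type) [MeasurableSpace X] [MulAction G X]
    (H : Type) [Group H] (Y : Type) [MeasurableSpace Y] [MulAction H Y]
    (μ : Measure X) (ν : Measure Y) : Prop :=
  ∃ α : G ≃* H, ConjugateVia G X H Y μ ν α

/-- Orbit equivalence of two actions. -/
def OrbitEquivalent (G : Type) [Group G] (X : Type) [MeasurableSpace X] [MulAction G X]
    (H : Type) [Group H] (Y : Type) [MeasurableSpace Y] [MulAction H Y]
    (μ : Measure X) (ν : Measure Y) : Prop :=
  ∃ F : X → Y, MeasIso μ ν F ∧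
    ∀ᵐ x ∂μ, F '' MulAction.orbit G x = MulAction.orbit H (F x)

/-- Measurable cocycle for an action, with values in a (discrete) group `H`. -/
def IsCocycle (G : Type) [Group G] (X : Type) [MeasurableSpace X] [MulAction G X]
    (H : Type) [Group H] (μ : Measure X) (c : G → X → H) : Prop :=
  (∀ (g : G) (h : H), MeasurableSet {x : X | c g x = h}) ∧
    ∀ g g' : G, ∀ᵐ x ∂μ, c (g * g') x = c g (g' • x) * c g' x

/-- Cohomology of cocycles. -/
def Cohomologous (G : Type) [Group G] (X : Type) [MeasurableSpace X] [MulAction G X]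
    (H : Type) [Group H] (μ : Measure X) (c c' : G → X → H) : Prop :=
  ∃ φ : X → H, (∀ h : H, MeasurableSet {x : X | φ x = h}) ∧
    ∀ g : G, ∀ᵐ x ∂μ, c' g x = φ (g • x) * c g x * (φ x)⁻¹

/-- A stable orbit equivalence between two actions: a measure-scaling Borel isomorphism
between positive measure subsets, matching orbits. -/
structure StableOE (G : Type) [Group G] (X : Type) [MeasurableSpace X] [MulAction G X]
    (H : Type) [Group H] (Y : Type) [MeasurableSpace Y] [MulAction H Y]
    (μ : Measure X) (ν : Measure Y) where
  U : Set X
  V : Set Y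
  measU : MeasurableSet U
  measV : MeasurableSet V
  posU : 0 < μ U
  posV : 0 < ν V
  toFun : X → Y
  invFun : Y → X
  meas_toFun : Measurable toFun
  meas_invFun : Measurable invFun
  maps : Set.MapsTo toFun U V
  maps_inv : Set.MapsTo invFun V U
  left_inv : ∀ x ∈ U, invFun (toFun x) = x
  right_inv : ∀ y ∈ V, toFun (invFun y) = y
  pushforward : ∀ B : Set Y, B ⊆ V → MeasurableSet B →
    (μ U)⁻¹ * μ (U ∩ toFun ⁻¹' B) = (ν V)⁻¹ * ν B
  orbit_eq : ∀ᵐ x ∂μ, x ∈ U →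
    toFun '' (MulAction.orbit G x ∩ U) = MulAction.orbit H (toFun x) ∩ V

namespace StableOE

variable {G : Type} [Group G] {X : Type} [MeasurableSpace X] [MulAction G X]
  {H : Type} [Group H] {Y : Type} [MeasurableSpace Y] [MulAction H Y]
  {μ : Measure X} {ν : Measure Y}

/-- The compression constant of a stable orbit equivalence. -/
noncomputable def kappa (f : StableOE G X H Y μ ν) : ℝ≥0∞ := ν f.V / μ f.U

/-- `c` is an SOE cocycle associated to the stable orbit equivalence `f`. -/
def IsSOECocycle (f : StableOE G X H Y μ ν) (c : G → X → H) : Prop :=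
  IsCocycle G X H μ c ∧
    ∃ p : X → X, Measurable p ∧
      (∀ᵐ x ∂μ, p x ∈ f.U ∧ p x ∈ MulAction.orbit G x) ∧
      ∀ g : G, ∀ᵐ x ∂μ, f.toFun (p (g • x)) = c g x • f.toFun (p x)

end StableOE

/-- Mildly mixing action. -/
def MildlyMixing (H : Type) [Group H] (Y : Type) [MeasurableSpace Y] [MulAction H Y]
    (ν : Measure Y) : Prop :=
  ∀ A : Set Y, MeasurableSet A → ν A ≠ 0 → ν A ≠ ν Set.univ →
    ∀ u : ℕ → H, Function.Injective u →
      0 < Filter.atTop.liminf fun n => ν (((u n • ·) '' A) ∆ A)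

/- ## Virtual conjugacy -/

/-- `(Z, qact, ρ)` together with `π : X → Z` is a model for the quotient of the action
`G ↷ (X, μ)` by the normal subgroup `F`, with the induced `G ⧸ F`-action. -/
def IsQuotientModel {G : Type} [Group G] (F : Subgroup G) [F.Normal]
    {X : Type} [MeasurableSpace X] [MulAction G X] (μ : Measure X)
    {Z : Type} [MeasurableSpace Z] (qact : G ⧸ F →* Equiv.Perm Z) (ρ : Measure Z)
    (π : X → Z) : Prop :=
  Measurable π ∧ Measure.map π μ = ρ ∧
    (∀ (g : G) (x : X), π (g • x) = qact (QuotientGroup.mk g) (π x)) ∧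
    ∀ x y : X, π x = π y ↔ ∃ f ∈ F, f • x = y

/-- The action `act : Q →* Perm Z` on `(Z, ρ)` is (isomorphic to) the action induced from the
action `act' : K →* Perm X'` of the finite-index subgroup `K` on `(X', μ')`. -/
def InducedFrom {Q : Type} [Group Q] (K : Subgroup Q)
    {Z : Type} [MeasurableSpace Z] (act : Q →* Equiv.Perm Z) (ρ : Measure Z)
    {X' : Type} [MeasurableSpace X'] (act' : ↥K →* Equiv.Perm X') (μ' : Measure X') : Prop :=
  letI : MeasurableSpace (Q ⧸ K) := ⊤
  ∃ σ : Q ⧸ K → Q, (∀ k : Q ⧸ K, (QuotientGroup.mk (σ k) : Q ⧸ K) = k) ∧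
    ∃ Φ : X' × (Q ⧸ K) → Z,
      MeasIso (Measure.sum fun k : Q ⧸ K =>
        (K.index : ℝ≥0∞)⁻¹ • Measure.map (fun x' : X' => (x', k)) μ') ρ Φ ∧
      ∀ (g : Q) (k : Q ⧸ K) (h : ↥K), (h : Q) = (σ (g • k))⁻¹ * g * σ k →
        ∀ᵐ x' ∂μ', Φ (act' h x', g • k) = act g (Φ (x', k))

/-- Data witnessing that two probability measure-preserving actions are virtually
conjugate. -/
structure VirtualConjugacyData
    (G₁ : Type) [Group G₁] (X₁ : Type) [MeasurableSpace X₁] [MulAction G₁ X₁] (μ₁ : Measure X₁)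
    (G₂ : Type) [Group G₂] (X₂ : Type) [MeasurableSpace X₂] [MulAction G₂ X₂] (μ₂ : Measure X₂) :
    Type 1 where
  F₁ : Subgroup G₁
  F₂ : Subgroup G₂
  normal₁ : F₁.Normal
  normal₂ : F₂.Normal
  finite₁ : Finite F₁
  finite₂ : Finite F₂
  K₁ : Subgroup (G₁ ⧸ F₁)
  K₂ : Subgroup (G₂ ⧸ F₂)
  finiteIndex₁ : K₁.FiniteIndex
  finiteIndex₂ : K₂.FiniteIndex
  X'₁ : Type
  X'₂ : Type
  mX'₁ : MeasurableSpace X'₁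
  mX'₂ : MeasurableSpace X'₂
  μ'₁ : Measure X'₁
  μ'₂ : Measure X'₂
  prob₁ : IsProbabilityMeasure μ'₁
  prob₂ : IsProbabilityMeasure μ'₂
  act₁ : ↥K₁ →* Equiv.Perm X'₁
  act₂ : ↥K₂ →* Equiv.Perm X'₂
  pmp₁ : ∀ k : ↥K₁, MeasurePreserving (act₁ k) μ'₁ μ'₁
  pmp₂ : ∀ k : ↥K₂, MeasurePreserving (act₂ k) μ'₂ μ'₂
  θ : ↥K₁ ≃* ↥K₂
  conjF : X'₁ → X'₂
  conjF_iso : MeasIso μ'₁ μ'₂ conjF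
  conjF_equivariant : ∀ k : ↥K₁, ∀ᵐ x ∂μ'₁, conjF (act₁ k x) = act₂ (θ k) (conjF x)
  Z₁ : Type
  Z₂ : Type
  mZ₁ : MeasurableSpace Z₁
  mZ₂ : MeasurableSpace Z₂
  ρ₁ : Measure Z₁
  ρ₂ : Measure Z₂
  qact₁ : G₁ ⧸ F₁ →* Equiv.Perm Z₁
  qact₂ : G₂ ⧸ F₂ →* Equiv.Perm Z₂
  qpmp₁ : ∀ g, MeasurePreserving (qact₁ g) ρ₁ ρ₁
  qpmp₂ : ∀ g, MeasurePreserving (qact₂ g) ρ₂ ρ₂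
  π₁ : X₁ → Z₁
  π₂ : X₂ → Z₂
  quot₁ : IsQuotientModel F₁ μ₁ qact₁ ρ₁ π₁
  quot₂ : IsQuotientModel F₂ μ₂ qact₂ ρ₂ π₂
  ind₁ : InducedFrom K₁ qact₁ ρ₁ act₁ μ'₁
  ind₂ : InducedFrom K₂ qact₂ ρ₂ act₂ μ'₂

/- ## Bernoulli actions -/

/-- The Bernoulli shift action of `G` on `G → A`. -/
instance bernoulliAction (G A : Type) [Group G] : MulAction G (G → A) where
  smul g x := fun h => x (g⁻¹ * h)
  one_smul x := funext fun h => by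
    show x (1⁻¹ * h) = x h
    rw [inv_one, one_mul]
  mul_smul g g' x := funext fun h => by
    show x ((g * g')⁻¹ * h) = x (g'⁻¹ * (g⁻¹ * h))
    rw [mul_inv_rev, mul_assoc]

/-- `μ` is the product (Bernoulli) measure on `G → A` with base `μ₀`:
it gives the product value to every cylinder set. -/
def IsBernoulliMeasure (G : Type) [Group G] {A : Type} [MeasurableSpace A]
    (μ₀ : Measure A) (μ : Measure (G → A)) : Prop :=
  ∀ (s : Finset G) (B : G → Set A), (∀ g : G, MeasurableSet (B g)) →
    μ {x : G → A | ∀ g ∈ s, x g ∈ B g} = ∏ g ∈ s, μ₀ (B g)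


/-- `𝓕`-ergodicity: every subgroup in the collection `𝓕` acts ergodically. -/
def FErgodic (G : Type) [Group G] (𝓕 : Set (Subgroup G)) (X : Type) [MeasurableSpace X]
    [MulAction G X] (μ : Measure X) : Prop :=
  ∀ A ∈ 𝓕, ErgodicSubgroup G A X μ

/-- Strong cocycle-rigidity of the pair `(G, 𝓕)`. -/
def StronglyCocycleRigid (G : Type) [Group G] (𝓕 : Set (Subgroup G)) : Prop :=
  ∀ (X : Type) [MeasurableSpace X] [StandardBorelSpace X] (μ : Measure X)
    (Y : Type) [MeasurableSpace Y] [StandardBorelSpace Y] (ν : Measure Y)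
    [IsProbabilityMeasure μ] [IsProbabilityMeasure ν]
    [MulAction G X] [MulAction G Y],
    PmpAction G X μ → FreeAction G X μ → ErgodicAction G X μ → FErgodic G 𝓕 X μ →
    PmpAction G Y ν → FreeAction G Y ν → ErgodicAction G Y ν → FErgodic G 𝓕 Y ν →
    ∀ f : StableOE G X G Y μ ν, ∀ c : G → X → G, f.IsSOECocycle c →
      ∃ α : G ≃* G, Cohomologous G X G μ c fun g _ => α g



section Magnus

open Polynomial

/-- Elements of `B[X]` with constant coefficient `1` are determined by their positive powers. -/
theorem polynomial_pow_left_injective {B : Type*} [Ring B] [Module ℚ B] {a b : B[X]}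
    (ha : a.coeff 0 = 1) (hb : b.coeff 0 = 1) {k : ℕ} (hk : k ≠ 0) (h : a ^ k = b ^ k) :
    a = b := by
  by_contra hab
  have hd : a - b ≠ 0 := sub_ne_zero.mpr hab
  set j := (a - b).natTrailingDegree with hj
  obtain ⟨e, he⟩ : (X : B[X]) ^ j ∣ a - b :=
    X_pow_dvd_iff.mpr fun d hd' => coeff_eq_zero_of_lt_natTrailingDegree hd'
  have he0 : e.coeff 0 ≠ 0 := by
    have : (a - b).coeff j ≠ 0 := by
      rw [hj]; exact trailingCoeff_nonzero_iff_nonzero.mpr hd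
    rw [he] at this
    simpa [coeff_X_pow_mul'] using this
  have ha' (n : ℕ) : (a ^ n).coeff 0 = 1 := by
    have := map_pow (constantCoeff (R := B)) a n
    simpa [ha] using this
  have key (n : ℕ) : ∃ q : B[X], a ^ n - b ^ n = X ^ j * q ∧ q.coeff 0 = n • e.coeff 0 := by
    induction n with
    | zero => exact ⟨0, by simp, by simp⟩
    | succ n ih =>
      obtain ⟨q, hq, hq0⟩ := ih
      refine ⟨a ^ n * e + q * b, ?_, ?_⟩
      · calc a ^ (n + 1) - b ^ (n + 1) = a ^ n * (a - b) + (a ^ n - b ^ n) * b := by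
              rw [pow_succ, pow_succ]; noncomm_ring
          _ = _ := by
              rw [he, hq, mul_add, ← mul_assoc, ← (commute_X_pow (a ^ n) j).eq, mul_assoc,
                mul_assoc]
      · simp [mul_coeff_zero, ha', hb, hq0, add_smul, add_comm]
  obtain ⟨q, hq, hq0⟩ := key k
  rw [h, sub_self] at hq
  have hq' : q.coeff 0 = 0 := by
    have := congrArg (fun r : B[X] => r.coeff j) hq
    simpa [coeff_X_pow_mul'] using this.symm
  rw [hq', ← Nat.cast_smul_eq_nsmul ℚ] at hq0
  exact (smul_ne_zero (by exact_mod_cast hk) he0) hq0.symm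

variable {V : Type} (Γ : SimpleGraph V)

/-- Update of the set of letters that can be shuffled to the end of a word, when the letter `v`
is appended to that word. -/
def lastStep (S : Set V) (v : V) : Set V := {u | u = v ∨ (u ∈ S ∧ Γ.Adj u v)}

theorem lastStep_comm (S : Set V) {u v : V} (h : Γ.Adj u v) :
    lastStep Γ (lastStep Γ S u) v = lastStep Γ (lastStep Γ S v) u := by
  ext w
  have := h.symm
  simp only [lastStep, Set.mem_ofPred_eq]
  grind

open Classical in
/-- The square-zero operator attached to a vertex. -/
noncomputable def vertexOp (v : V) : Module.End ℚ (Set V → ℚ) where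
  toFun ξ S := if v ∈ S then 0 else ξ (lastStep Γ S v)
  map_add' ξ η := by ext S; by_cases h : v ∈ S <;> simp [h]
  map_smul' r ξ := by ext S; by_cases h : v ∈ S <;> simp [h]

theorem vertexOp_mul_self (v : V) : vertexOp Γ v * vertexOp Γ v = 0 := by
  ext ξ S
  simp [vertexOp, lastStep]

theorem vertexOp_comm {u v : V} (h : Γ.Adj u v) :
    vertexOp Γ u * vertexOp Γ v = vertexOp Γ v * vertexOp Γ u := by
  refine LinearMap.ext fun ξ => funext fun S => ?_
  have h' := h.symm
  have huv := h.ne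
  have h3 := lastStep_comm Γ S h
  simp only [vertexOp, Module.End.mul_apply, LinearMap.coe_mk, AddHom.coe_mk]
  have h1 : v ∈ lastStep Γ S u ↔ v ∈ S := by simp [lastStep, h', huv.symm]
  have h2 : u ∈ lastStep Γ S v ↔ u ∈ S := by simp [lastStep, h, huv]
  split_ifs <;> simp_all

/-- The degree one polynomial `1 + e N_v X`. -/
noncomputable def magnusPoly (v : V) (e : ℤ) : (Module.End ℚ (Set V → ℚ))[X] :=
  1 + C (e • vertexOp Γ v) * X

theorem magnusPoly_mul (v : V) (e e' : ℤ) :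
    magnusPoly Γ v e * magnusPoly Γ v e' = magnusPoly Γ v (e + e') := by
  have h : C (e • vertexOp Γ v) * X * (C (e' • vertexOp Γ v) * X) = 0 := by
    rw [mul_assoc, ← mul_assoc X, X_mul_C, mul_assoc, ← mul_assoc, ← C_mul, smul_mul_smul_comm,
      vertexOp_mul_self, smul_zero, C_0, zero_mul]
  simp only [magnusPoly, mul_add, add_mul, one_mul, mul_one, h, add_smul, C_add]
  abel

theorem magnusPoly_zero (v : V) : magnusPoly Γ v 0 = 1 := by simp [magnusPoly]

/-- The Magnus unit `1 + N_v X`. -/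
noncomputable def magnusUnit (v : V) : ((Module.End ℚ (Set V → ℚ))[X])ˣ where
  val := magnusPoly Γ v 1
  inv := magnusPoly Γ v (-1)
  val_inv := by rw [magnusPoly_mul]; simp [magnusPoly_zero]
  inv_val := by rw [magnusPoly_mul]; simp [magnusPoly_zero]

theorem magnusUnit_zpow (v : V) (e : ℤ) :
    ((magnusUnit Γ v ^ e : ((Module.End ℚ (Set V → ℚ))[X])ˣ) : (Module.End ℚ (Set V → ℚ))[X]) =
      magnusPoly Γ v e := by
  induction e with
  | zero => simp [magnusPoly_zero]
  | succ n ih => rw [zpow_add_one, Units.val_mul, ih]; exact magnusPoly_mul Γ v n 1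
  | pred n ih => rw [zpow_sub_one, Units.val_mul, ih]; exact magnusPoly_mul Γ v (-n) (-1)

theorem magnusUnit_comm {u v : V} (h : Γ.Adj u v) :
    magnusUnit Γ u * magnusUnit Γ v = magnusUnit Γ v * magnusUnit Γ u := by
  ext1
  have h' : C (vertexOp Γ u) * X * (C (vertexOp Γ v) * X) =
      C (vertexOp Γ v) * X * (C (vertexOp Γ u) * X) := by
    simp only [mul_assoc]
    simp only [← mul_assoc X, X_mul_C]
    simp only [← mul_assoc, ← C_mul, vertexOp_comm Γ h]
  simp only [magnusUnit, Units.val_mul, magnusPoly, one_smul, mul_add, add_mul, one_mul, mul_one,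
    h']
  abel

/-- The Magnus representation of a right-angled Artin group. -/
noncomputable def magnusHom : RAAG Γ →* ((Module.End ℚ (Set V → ℚ))[X])ˣ :=
  PresentedGroup.toGroup (f := magnusUnit Γ) (by
    rintro r ⟨u, v, h, rfl⟩
    simp only [map_mul, map_inv, FreeGroup.lift_apply_of, magnusUnit_comm Γ h]
    group)

theorem magnusHom_gen (v : V) : magnusHom Γ (gen Γ v) = magnusUnit Γ v :=
  PresentedGroup.toGroup.of _

theorem magnusHom_coeff_zero (g : RAAG Γ) :
    ((magnusHom Γ g : ((Module.End ℚ (Set V → ℚ))[X])ˣ) :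
      (Module.End ℚ (Set V → ℚ))[X]).coeff 0 = 1 := by
  have h : (Units.map (constantCoeff (R := Module.End ℚ (Set V → ℚ))).toMonoidHom).comp
      (magnusHom Γ) = 1 := by
    refine PresentedGroup.ext fun v => ?_
    ext1
    change ((magnusHom Γ (gen Γ v) : ((Module.End ℚ (Set V → ℚ))[X])ˣ) :
      (Module.End ℚ (Set V → ℚ))[X]).coeff 0 = 1
    rw [magnusHom_gen]
    simp [magnusUnit, magnusPoly]
  exact congrArg Units.val (DFunLike.congr_fun h g)

/-- The element of a right-angled Artin group represented by a list of syllables. -/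
def syllProd (l : List (V × ℤ)) : RAAG Γ := (l.map fun s => gen Γ s.1 ^ s.2).prod

/-- The set of letters that can be shuffled to the end of a word. -/
def lastLetters (S : Set V) (l : List (V × ℤ)) : Set V := l.foldl (fun S s => lastStep Γ S s.1) S

/-- No two syllables with the same letter can be shuffled together. -/
def IsReducedFrom : Set V → List (V × ℤ) → Prop
  | _, [] => True
  | S, s :: l => s.1 ∉ S ∧ s.2 ≠ 0 ∧ IsReducedFrom (lastStep Γ S s.1) l

theorem gen_comm {u v : V} (h : Γ.Adj u v) : Commute (gen Γ u) (gen Γ v) := by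
  have : (PresentedGroup.mk (raagRels Γ)) (FreeGroup.of u * FreeGroup.of v *
      (FreeGroup.of u)⁻¹ * (FreeGroup.of v)⁻¹) = 1 :=
    PresentedGroup.one_of_mem ⟨u, v, h, rfl⟩
  simp only [map_mul, map_inv] at this
  rw [mul_inv_eq_one, mul_inv_eq_iff_eq_mul] at this
  exact this

theorem exists_syllProd_of_mem_lastLetters {v : V} (l : List (V × ℤ))
    (hv : v ∈ lastLetters Γ ∅ l) :
    ∃ (l' : List (V × ℤ)) (e : ℤ), l'.length + 1 = l.length ∧
      syllProd Γ l = syllProd Γ l' * gen Γ v ^ e := by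
  induction l using List.reverseRecOn with
  | nil => simp [lastLetters] at hv
  | append_singleton l s ih =>
    obtain ⟨u, f⟩ := s
    simp only [lastLetters, List.foldl_append, List.foldl_cons, List.foldl_nil] at hv
    rcases hv with rfl | ⟨hv, hadj⟩
    · exact ⟨l, f, by simp, by simp [syllProd]⟩
    · obtain ⟨l', e, hl, hp⟩ := ih hv
      refine ⟨l' ++ [(u, f)], e, by simp [hl], ?_⟩
      have hc : gen Γ v ^ e * gen Γ u ^ f = gen Γ u ^ f * gen Γ v ^ e :=
        ((gen_comm Γ hadj).zpow_zpow e f).eq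
      simp only [syllProd, List.map_append, List.prod_append] at hp ⊢
      simp [hp, mul_assoc, hc]

theorem exists_shorter_of_not_isReducedFrom (p l : List (V × ℤ))
    (h : ¬ IsReducedFrom Γ (lastLetters Γ ∅ p) l) :
    ∃ l' : List (V × ℤ), l'.length < (p ++ l).length ∧ syllProd Γ l' = syllProd Γ (p ++ l) := by
  induction l generalizing p with
  | nil => simp [IsReducedFrom] at h
  | cons s l ih =>
    obtain ⟨v, e⟩ := s
    by_cases hv : v ∈ lastLetters Γ ∅ p
    · obtain ⟨p', f, hp, hprod⟩ := exists_syllProd_of_mem_lastLetters Γ p hv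
      refine ⟨p' ++ (v, f + e) :: l, by simp; omega, ?_⟩
      simp only [syllProd, List.map_append, List.prod_append] at hprod ⊢
      simp [hprod, zpow_add, mul_assoc]
    by_cases he : e = 0
    · exact ⟨p ++ l, by simp, by simp [syllProd, he]⟩
    · have h' : ¬ IsReducedFrom Γ (lastLetters Γ ∅ (p ++ [(v, e)])) l := by
        intro hl
        exact h ⟨hv, he, by simpa [lastLetters] using hl⟩
      simpa using ih _ h'

theorem exists_syllProd_eq (g : RAAG Γ) : ∃ l : List (V × ℤ), syllProd Γ l = g := by
  induction g using PresentedGroup.induction_on with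
  | _ z =>
  induction z using FreeGroup.induction_on with
  | C1 => exact ⟨[], by simp [syllProd]⟩
  | of v => exact ⟨[(v, 1)], by simp [syllProd]; rfl⟩
  | inv_of v _ => exact ⟨[(v, -1)], by simp [syllProd]; rfl⟩
  | mul x y hx hy =>
    obtain ⟨l, hl⟩ := hx
    obtain ⟨l', hl'⟩ := hy
    exact ⟨l ++ l', by rw [map_mul, ← hl, ← hl']; simp [syllProd]⟩

theorem exists_isReducedFrom_syllProd_eq (g : RAAG Γ) :
    ∃ l : List (V × ℤ), IsReducedFrom Γ ∅ l ∧ syllProd Γ l = g := by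
  have h : ∀ (n : ℕ) (l : List (V × ℤ)), l.length = n →
      ∃ l' : List (V × ℤ), IsReducedFrom Γ ∅ l' ∧ syllProd Γ l' = syllProd Γ l := by
    intro n
    induction n using Nat.strong_induction_on with
    | _ n ih =>
    intro l hl
    by_cases hr : IsReducedFrom Γ ∅ l
    · exact ⟨l, hr, rfl⟩
    · obtain ⟨l', hlen, hprod⟩ := exists_shorter_of_not_isReducedFrom Γ [] l hr
      obtain ⟨l'', hr'', hprod''⟩ := ih l'.length (by simpa [hl] using hlen) l' rfl
      exact ⟨l'', hr'', hprod''.trans hprod⟩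
  obtain ⟨l, rfl⟩ := exists_syllProd_eq Γ g
  exact h _ l rfl

theorem vertexOp_prod_ne_zero (S : Set V) (l : List (V × ℤ)) (h : IsReducedFrom Γ S l) :
    ((l.map fun s => s.2 • vertexOp Γ s.1).prod (fun _ => (1 : ℚ))) S ≠ 0 := by
  induction l generalizing S with
  | nil => simp
  | cons s l ih =>
    obtain ⟨hs, he, hl⟩ := h
    have := ih _ hl
    simp only [List.map_cons, List.prod_cons, Module.End.mul_apply]
    simp only [vertexOp, LinearMap.smul_apply, LinearMap.coe_mk, AddHom.coe_mk, Pi.smul_apply,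
      if_neg hs]
    exact smul_ne_zero he this

theorem magnusHom_injective : Function.Injective (magnusHom Γ) := by
  rw [injective_iff_map_eq_one]
  intro g hg
  obtain ⟨l, hl, rfl⟩ := exists_isReducedFrom_syllProd_eq Γ g
  rcases eq_or_ne l [] with rfl | hne
  · simp [syllProd]
  exfalso
  have hprod : ((magnusHom Γ (syllProd Γ l) : ((Module.End ℚ (Set V → ℚ))[X])ˣ) :
      (Module.End ℚ (Set V → ℚ))[X]) = (l.map fun s => magnusPoly Γ s.1 s.2).prod := by
    rw [syllProd, map_list_prod, ← Units.coeHom_apply, map_list_prod, List.map_map, List.map_map]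
    congr 1
    refine List.map_congr_left fun s _ => ?_
    simp [magnusHom_gen, magnusUnit_zpow]
  have hcoeff := coeff_list_prod_of_natDegree_le (l.map fun s => magnusPoly Γ s.1 s.2) 1 (by
    intro p hp
    obtain ⟨s, -, rfl⟩ := List.mem_map.mp hp
    unfold magnusPoly
    compute_degree)
  rw [← hprod, hg, List.map_map] at hcoeff
  have hlen : l.length ≠ 0 := by simpa using hne
  apply vertexOp_prod_ne_zero Γ ∅ l hl
  have h1 : (l.map fun s => s.2 • vertexOp Γ s.1).prod = 0 := by
    rw [show (fun s : V × ℤ => s.2 • vertexOp Γ s.1) =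
      (fun p => coeff p 1) ∘ (fun s => magnusPoly Γ s.1 s.2) from ?_, ← hcoeff]
    · simp [coeff_one, hne]
    · funext s
      simp [magnusPoly, coeff_one]
  rw [h1]
  rfl

/-- Right-angled Artin groups have unique roots. -/
theorem raag_pow_left_injective {k : ℕ} (hk : k ≠ 0) :
    Function.Injective fun g : RAAG Γ => g ^ k := by
  intro a b hab
  refine magnusHom_injective Γ (Units.ext ?_)
  refine polynomial_pow_left_injective (magnusHom_coeff_zero Γ a) (magnusHom_coeff_zero Γ b) hk ?_
  have := congrArg (fun g => ((magnusHom Γ g : ((Module.End ℚ (Set V → ℚ))[X])ˣ) :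
      (Module.End ℚ (Set V → ℚ))[X])) hab
  simpa using this

theorem raag_eq_one_of_pow_eq_one {g : RAAG Γ} {k : ℕ} (hk : k ≠ 0) (h : g ^ k = 1) : g = 1 :=
  raag_pow_left_injective Γ hk (by simpa using h)

theorem raag_rootConjugationProperty : RootConjugationProperty (RAAG Γ) := by
  intro a b k hk h
  have : a * b * a⁻¹ = b := raag_pow_left_injective Γ hk.ne' (by
    simp only [conj_pow]
    rw [h.eq, mul_inv_cancel_right])
  exact mul_inv_eq_iff_eq_mul.mp this

end Magnus

section Dynamics

variable {G X H Y : Type} [Group G] [Group H] [MeasurableSpace X] [MeasurableSpace Y]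
  [MulAction G X] [MulAction H Y] {μ : Measure X} {ν : Measure Y}

theorem PmpAction.ae_forall_smul [Countable G] (hX : PmpAction G X μ) {P : X → Prop}
    (hP : ∀ᵐ x ∂μ, P x) : ∀ᵐ x ∂μ, ∀ g : G, P (g • x) :=
  ae_all_iff.mpr fun g => (hX g).quasiMeasurePreserving.ae hP

theorem FreeAction.ae_ne [Countable G] (hX : FreeAction G X μ) :
    ∀ᵐ x ∂μ, ∀ g : G, g • x = x → g = 1 := by
  refine ae_all_iff.mpr fun g => ?_
  by_cases hg : g = 1
  · simp [hg]
  · have : ∀ᵐ x ∂μ, ¬ g • x = x := by simpa [ae_iff] using hX g hg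
    filter_upwards [this] with x hx hx'
    exact absurd hx' hx

theorem exists_measure_ne_zero_of_ae_mem_iUnion {ι : Type*} [Countable ι] [NeZero μ]
    {A : ι → Set X} (h : ∀ᵐ x ∂μ, x ∈ ⋃ i, A i) : ∃ i, μ (A i) ≠ 0 := by
  by_contra! hA
  have h0 : ∀ᵐ x ∂μ, x ∉ ⋃ i, A i := by
    rw [ae_iff]
    simp only [not_not]
    exact measure_iUnion_null hA
  obtain ⟨x, hx, hx'⟩ := (h.and h0).exists
  exact hx' hx

/-- A map to a countable group with the root-conjugation property that is equivariant with respect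
to an ergodic transformation and an inner automorphism is constant. -/
theorem ae_eq_const_of_ae_comp_eq_conj [Countable H] (hH : RootConjugationProperty H)
    [IsProbabilityMeasure μ] {T : X → X} (hT : Ergodic T μ) {k : X → H}
    (hk : ∀ h, MeasurableSet {x | k x = h}) {h₀ : H}
    (hTk : ∀ᵐ x ∂μ, k (T x) = h₀ * k x * h₀⁻¹) : ∃ h, ∀ᵐ x ∂μ, k x = h := by
  obtain ⟨h, hh⟩ := exists_measure_ne_zero_of_ae_mem_iUnion (μ := μ) (A := fun h => {x | k x = h})
    (by simp)
  have hiter : ∀ n : ℕ, ∀ᵐ x ∂μ, k (T^[n] x) = h₀ ^ n * k x * (h₀ ^ n)⁻¹ := by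
    intro n
    induction n with
    | zero => simp
    | succ n ih =>
      filter_upwards [ih, (hT.toMeasurePreserving.iterate n).quasiMeasurePreserving.ae hTk]
        with x hx hx'
      rw [Function.iterate_succ_apply', hx', hx, pow_succ']
      group
  have hcomm : Commute h h₀ := by
    set s := {x | ∀ n : ℕ, k (T^[n] x) = h₀ ^ n * k x * (h₀ ^ n)⁻¹}
    have hs : μ sᶜ = 0 := ae_all_iff.mpr hiter
    obtain ⟨x, ⟨hx, hxn⟩, m, hm, hx', -⟩ :=
      hT.toMeasurePreserving.conservative.exists_mem_iterate_mem
        ((hk h).nullMeasurableSet.inter (.of_compl (.of_null hs)))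
        (by rwa [measure_inter_conull hs])
    have h1 := hxn m
    simp only [Set.mem_ofPred_eq] at hx hx'
    rw [hx, hx', eq_mul_inv_iff_mul_eq] at h1
    exact hH h h₀ m (Nat.pos_of_ne_zero hm) h1
  have hinv : T ⁻¹' {x | k x = h} =ᵐ[μ] {x | k x = h} := by
    refine Filter.eventuallyEq_set.mpr ?_
    filter_upwards [hTk] with x hx
    simp only [Set.mem_preimage, Set.mem_ofPred_eq, hx]
    rw [mul_inv_eq_iff_eq_mul, hcomm.eq, mul_right_inj]
  refine ⟨h, ?_⟩
  rcases hT.quasiErgodic.ae_empty_or_univ₀ (hk h).nullMeasurableSet hinv with h0 | h1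
  · exact absurd (by simpa using h0) hh
  · filter_upwards [Filter.eventuallyEq_set.mp h1] with x hx
    exact hx.mpr trivial

/-- The cocycle `φ(gx) c(g,x) φ(x)⁻¹`. -/
def twist (φ : X → H) (c : G → X → H) (g : G) (x : X) : H := φ (g • x) * c g x * (φ x)⁻¹

theorem IsCocycle.twist [Countable H] (hX : PmpAction G X μ) {c : G → X → H}
    (hc : IsCocycle G X H μ c) {φ : X → H} (hφ : ∀ h, MeasurableSet {x | φ x = h}) :
    IsCocycle G X H μ (twist φ c) := by
  refine ⟨fun g h => ?_, fun g g' => ?_⟩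
  · have : {x | OEPaper.twist φ c g x = h} = ⋃ (a : H) (b : H),
        ((fun x => g • x) ⁻¹' {x | φ x = a}) ∩ ({x | c g x = b} ∩ {x | φ x = h⁻¹ * (a * b)}) := by
      ext x
      simp only [OEPaper.twist, Set.mem_ofPred_eq, Set.mem_iUnion, Set.mem_inter_iff,
        Set.mem_preimage, exists_eq_left', exists_and_left]
      rw [mul_inv_eq_iff_eq_mul, eq_inv_mul_iff_mul_eq, eq_comm]
    rw [this]
    exact .iUnion fun a => .iUnion fun b =>
      ((hX g).measurable (hφ a)).inter ((hc.1 g b).inter (hφ _))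
  · filter_upwards [hc.2 g g'] with x hx
    simp only [OEPaper.twist, hx, mul_smul]
    group

/-- A cocycle whose restriction to every element is constant is a homomorphism. -/
theorem IsCocycle.exists_hom [NeZero μ] {c : G → X → H} (hX : PmpAction G X μ)
    (hc : IsCocycle G X H μ c) (h : ∀ g, ∃ a, ∀ᵐ x ∂μ, c g x = a) :
    ∃ α : G →* H, ∀ g, ∀ᵐ x ∂μ, c g x = α g := by
  choose a ha using h
  refine ⟨MonoidHom.mk' a fun g g' => ?_, ha⟩
  obtain ⟨x, h1, h2, h3, h4⟩ := ((ha (g * g')).and ((ha g').and (((hX g').quasiMeasurePreserving.ae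
    (ha g)).and (hc.2 g g')))).exists
  rw [← h1, h4, h2, h3]

theorem IsCocycle.ae_const_mul {c : G → X → H} (hX : PmpAction G X μ)
    (hc : IsCocycle G X H μ c) {g g' : G} (h : ∃ a, ∀ᵐ x ∂μ, c g x = a)
    (h' : ∃ a, ∀ᵐ x ∂μ, c g' x = a) : ∃ a, ∀ᵐ x ∂μ, c (g * g') x = a := by
  obtain ⟨a, ha⟩ := h
  obtain ⟨a', ha'⟩ := h'
  refine ⟨a * a', ?_⟩
  filter_upwards [(hX g').quasiMeasurePreserving.ae ha, ha', hc.2 g g'] with x h1 h2 h3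
  rw [h3, h1, h2]

theorem IsCocycle.ae_one {c : G → X → H} (hc : IsCocycle G X H μ c) : ∀ᵐ x ∂μ, c 1 x = 1 := by
  filter_upwards [hc.2 1 1] with x hx
  simpa using hx

theorem IsCocycle.ae_const_inv {c : G → X → H} (hX : PmpAction G X μ)
    (hc : IsCocycle G X H μ c) {g : G} (h : ∃ a, ∀ᵐ x ∂μ, c g x = a) :
    ∃ a, ∀ᵐ x ∂μ, c g⁻¹ x = a := by
  obtain ⟨a, ha⟩ := h
  refine ⟨a⁻¹, ?_⟩
  filter_upwards [(hX g⁻¹).quasiMeasurePreserving.ae ha, hc.2 g g⁻¹, hc.ae_one] with x h1 h2 h3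
  rw [mul_inv_cancel, h3, h1] at h2
  exact (inv_eq_of_mul_eq_one_right h2.symm).symm

theorem IsCocycle.exists_hom_of_raag [Countable H] (hH : RootConjugationProperty H)
    [IsProbabilityMeasure μ] {V : Type} {Γ : SimpleGraph V} (hΓ : Γ.Connected)
    [MulAction (RAAG Γ) X] {c : RAAG Γ → X → H} (hX : PmpAction (RAAG Γ) X μ)
    (hc : IsCocycle (RAAG Γ) X H μ c) (hgen : ∀ v, Ergodic (fun x : X => gen Γ v • x) μ)
    {v : V} (hv : ∃ a, ∀ᵐ x ∂μ, c (gen Γ v) x = a) :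
    ∃ α : RAAG Γ →* H, ∀ g, ∀ᵐ x ∂μ, c g x = α g := by
  have step : ∀ {u w : V}, Γ.Adj u w → (∃ a, ∀ᵐ x ∂μ, c (gen Γ u) x = a) →
      ∃ a, ∀ᵐ x ∂μ, c (gen Γ w) x = a := by
    rintro u w hadj ⟨a, ha⟩
    refine ae_eq_const_of_ae_comp_eq_conj hH (hgen u) (hc.1 _) (h₀ := a) ?_
    filter_upwards [ha, (hX (gen Γ w)).quasiMeasurePreserving.ae ha, hc.2 (gen Γ u) (gen Γ w),
      hc.2 (gen Γ w) (gen Γ u)] with x h1 h2 h3 h4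
    rw [(gen_comm Γ hadj).eq, h4, h1, h2] at h3
    exact eq_mul_inv_of_mul_eq h3
  have hall : ∀ w, ∃ a, ∀ᵐ x ∂μ, c (gen Γ w) x = a := by
    intro w
    obtain ⟨p⟩ := hΓ.preconnected v w
    induction p with
    | nil => exact hv
    | cons h _ ih => exact ih (step h hv)
  refine hc.exists_hom hX fun g => ?_
  induction g using PresentedGroup.induction_on with
  | _ z =>
  induction z using FreeGroup.induction_on with
  | C1 => exact ⟨1, by simpa using hc.ae_one⟩
  | of v => exact hall v
  | inv_of v ih => rw [map_inv]; exact hc.ae_const_inv hX ih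
  | mul x y hx hy => rw [map_mul]; exact hc.ae_const_mul hX hx hy

namespace StableOE

variable (f : StableOE G X H Y μ ν)

theorem injOn : Set.InjOn f.toFun f.U := fun x hx y hy h => by
  rw [← f.left_inv x hx, h, f.left_inv y hy]

theorem kappa_ne_zero [IsFiniteMeasure μ] : f.kappa ≠ 0 :=
  ENNReal.div_ne_zero.mpr ⟨f.posV.ne', measure_ne_top _ _⟩

theorem measurableSet_image {B : Set X} (hBU : B ⊆ f.U) (hB : MeasurableSet B) :
    MeasurableSet (f.toFun '' B) := by
  have : f.toFun '' B = f.V ∩ f.invFun ⁻¹' B := by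
    ext y
    constructor
    · rintro ⟨x, hx, rfl⟩
      exact ⟨f.maps (hBU hx), by simpa [f.left_inv x (hBU hx)] using hx⟩
    · rintro ⟨hy, hy'⟩
      exact ⟨_, hy', f.right_inv y hy⟩
  rw [this]
  exact f.measV.inter (f.meas_invFun hB)

theorem measure_image [IsFiniteMeasure μ] [IsFiniteMeasure ν] {B : Set X} (hBU : B ⊆ f.U)
    (hB : MeasurableSet B) : ν (f.toFun '' B) = f.kappa * μ B := by
  have h := f.pushforward (f.toFun '' B) (f.maps.mono_left hBU).image_subset
    (f.measurableSet_image hBU hB)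
  rw [Set.inter_comm, f.injOn.preimage_image_inter hBU] at h
  rw [kappa, ENNReal.div_eq_inv_mul, mul_right_comm, h, mul_right_comm,
    ENNReal.inv_mul_cancel f.posV.ne' (measure_ne_top _ _), one_mul]

end StableOE

/-- A stable orbit equivalence of compression at least one whose cocycle is cohomologous to a
homomorphism `α` defined on a torsion-free group comes from a conjugacy through `α`. -/
theorem StableOE.conjugateVia_of_hom [Countable G] [Countable H] [StandardBorelSpace X]
    [StandardBorelSpace Y] [IsProbabilityMeasure μ] [IsProbabilityMeasure ν]
    (hX : PmpAction G X μ) (hXfree : FreeAction G X μ) (hY : PmpAction H Y ν)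
    (hYfree : FreeAction H Y ν) (hG : ∀ (g : G) (n : ℕ), n ≠ 0 → g ^ n = 1 → g = 1)
    (f : StableOE G X H Y μ ν) (hκ : 1 ≤ f.kappa) {c : G → X → H} (hc : f.IsSOECocycle c)
    {φ : X → H} (hφ : ∀ h, MeasurableSet {x | φ x = h}) (α : G →* H)
    (hα : ∀ g, ∀ᵐ x ∂μ, α g = φ (g • x) * c g x * (φ x)⁻¹) :
    f.kappa = 1 ∧ ∃ β : G ≃* H, (∀ g, β g = α g) ∧ ConjugateVia G X H Y μ ν β := by
  obtain ⟨-, p, hp, hpU, hpc⟩ := hc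
  set F : X → Y := fun x => φ x • f.toFun (p x) with hF
  have hFmeas : Measurable F := by
    intro B hB
    have : F ⁻¹' B = ⋃ h : H, {x | φ x = h} ∩ ((fun x => h • f.toFun (p x)) ⁻¹' B) := by
      ext x
      simp [hF]
    rw [this]
    exact .iUnion fun h => (hφ h).inter (((hY h).measurable.comp (f.meas_toFun.comp hp)) hB)
  have hFequiv : ∀ᵐ x ∂μ, ∀ g, F (g • x) = α g • F x := by
    refine ae_all_iff.mpr fun g => ?_
    filter_upwards [hpc g, hα g] with x h1 h2
    simp only [hF, h1, h2, smul_smul, inv_mul_cancel_right]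
  -- the pieces on which `F` is a composition of `f` with group elements
  set A : G × H → Set X := fun i => {x | φ x = i.2} ∩ ({x | p x = i.1 • x} ∩
    (fun x => i.1 • x) ⁻¹' f.U) with hA
  have hAmeas : ∀ i, MeasurableSet (A i) := fun i =>
    (hφ _).inter ((measurableSet_eq_fun hp (hX _).measurable).inter ((hX _).measurable f.measU))
  have himg : ∀ i, ∀ B ⊆ A i, MeasurableSet B →
      MeasurableSet (F '' B) ∧ ν (F '' B) = f.kappa * μ B := by
    rintro ⟨g, h⟩ B hBA hB
    have h1 : (fun x => g • x) '' B = (fun x => g⁻¹ • x) ⁻¹' B := Set.image_smul.trans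
      (Set.preimage_smul_inv g B).symm
    have h2 (D : Set Y) : (fun y => h • y) '' D = (fun y => h⁻¹ • y) ⁻¹' D := Set.image_smul.trans
      (Set.preimage_smul_inv h D).symm
    have h3 : F '' B = (fun y => h • y) '' (f.toFun '' ((fun x => g • x) '' B)) := by
      rw [Set.image_image, Set.image_image]
      refine Set.image_congr fun x hx => ?_
      obtain ⟨hx1, hx2, -⟩ := hBA hx
      simp only [Set.mem_ofPred_eq] at hx1 hx2
      simp only [hF, hx1, hx2]
    have h4 : (fun x => g • x) '' B ⊆ f.U := by
      rintro _ ⟨x, hx, rfl⟩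
      exact (hBA hx).2.2
    have h5 : MeasurableSet ((fun x => g • x) '' B) := h1 ▸ (hX g⁻¹).measurable hB
    have h6 := f.measurableSet_image h4 h5
    rw [h3, h2]
    refine ⟨(hY h⁻¹).measurable h6, ?_⟩
    rw [(hY h⁻¹).measure_preimage h6.nullMeasurableSet, f.measure_image h4 h5, h1,
      (hX g⁻¹).measure_preimage hB.nullMeasurableSet]
  have hAcover : ∀ᵐ x ∂μ, x ∈ ⋃ i, A i := by
    filter_upwards [hpU] with x ⟨hx, g, hg⟩
    simp only at hg
    exact Set.mem_iUnion.mpr ⟨(g, φ x), rfl, hg.symm, by simpa [hg] using hx⟩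
  have hFac : Measure.QuasiMeasurePreserving F μ ν := by
    refine ⟨hFmeas, Measure.AbsolutelyContinuous.mk fun B hB hB0 => ?_⟩
    rw [Measure.map_apply hFmeas hB]
    have : ∀ i, μ (F ⁻¹' B ∩ A i) = 0 := by
      intro i
      have h := (himg i (F ⁻¹' B ∩ A i) Set.inter_subset_right ((hFmeas hB).inter (hAmeas i))).2
      rw [measure_mono_null (Set.image_subset_iff.mpr Set.inter_subset_left) hB0] at h
      exact (mul_eq_zero.mp h.symm).resolve_left f.kappa_ne_zero
    rw [← measure_inter_conull (show μ (⋃ i, A i)ᶜ = 0 from hAcover), Set.inter_iUnion]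
    exact measure_iUnion_null this
  have hgood : ∀ᵐ x ∂μ, (∃ i, x ∈ A i) ∧ (∀ g : G, g • x = x → g = 1) ∧
      (∀ h : H, h • F x = F x → h = 1) ∧ (∀ g, F (g • x) = α g • F x) ∧
      f.toFun '' (MulAction.orbit G (p x) ∩ f.U) = MulAction.orbit H (f.toFun (p x)) ∩ f.V := by
    filter_upwards [hAcover, hXfree.ae_ne, hFac.ae hYfree.ae_ne, hFequiv,
      hX.ae_forall_smul f.orbit_eq, hpU] with x h1 h2 h3 h4 h5 ⟨h6, g, hg⟩
    refine ⟨by simpa using h1, h2, h3, h4, ?_⟩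
    simp only at hg
    rw [← hg]
    exact h5 g (hg ▸ h6)
  obtain ⟨X₀, hX₀, hX₀meas, hX₀μ⟩ : ∃ X₀ : Set X, (∀ x ∈ X₀, (∃ i, x ∈ A i) ∧
      (∀ g : G, g • x = x → g = 1) ∧
      (∀ h : H, h • F x = F x → h = 1) ∧ (∀ g, F (g • x) = α g • F x) ∧
      f.toFun '' (MulAction.orbit G (p x) ∩ f.U) =
        MulAction.orbit H (f.toFun (p x)) ∩ f.V) ∧ MeasurableSet X₀ ∧ ∀ᵐ x ∂μ, x ∈ X₀ := by
    obtain ⟨s, hs, hsm, hs0⟩ := exists_measurable_superset_of_null (ae_iff.mp hgood)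
    refine ⟨sᶜ, fun x hx => ?_, hsm.compl, by simpa [ae_iff] using hs0⟩
    by_contra hx'
    exact hx (hs hx')
  have hfiber : ∀ x ∈ X₀, ∀ x' ∈ X₀, ∀ h : H, h • F x = F x' → ∃ g, g • x = x' ∧ α g = h := by
    intro x hx x' hx' h hxx'
    obtain ⟨⟨i, -, hi2, hi3⟩, -, hfr, heq, horb⟩ := hX₀ x hx
    obtain ⟨⟨i', -, hi2', hi3'⟩, -⟩ := hX₀ x' hx'
    simp only [Set.mem_ofPred_eq] at hi2 hi2'
    have h1 : f.toFun (p x') ∈ f.toFun '' (MulAction.orbit G (p x) ∩ f.U) := by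
      rw [horb]
      refine ⟨⟨(φ x')⁻¹ * h * φ x, ?_⟩, f.maps (hi2' ▸ hi3')⟩
      simp only [hF] at hxx'
      simp only [mul_smul]
      rw [hxx', inv_smul_smul]
    obtain ⟨z, ⟨⟨g, hg⟩, hzU⟩, hz⟩ := h1
    have hz' := f.injOn hzU (hi2' ▸ hi3') hz
    simp only at hg
    refine ⟨i'.1⁻¹ * g * i.1, ?_, ?_⟩
    · rw [mul_smul, mul_smul, ← hi2, hg, hz', hi2', inv_smul_smul]
    · have hx'' : (i'.1⁻¹ * g * i.1) • x = x' := by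
        rw [mul_smul, mul_smul, ← hi2, hg, hz', hi2', inv_smul_smul]
      have h2 := heq (i'.1⁻¹ * g * i.1)
      rw [hx'', ← hxx'] at h2
      have h3 := hfr (h⁻¹ * α (i'.1⁻¹ * g * i.1)) (by rw [mul_smul, ← h2, inv_smul_smul])
      exact (inv_mul_eq_one.mp h3).symm
  have hαinj : Function.Injective α := by
    rw [injective_iff_map_eq_one]
    intro k hk
    obtain ⟨i, hi⟩ := exists_measure_ne_zero_of_ae_mem_iUnion hAcover
    obtain ⟨x, ⟨hxA, hx0⟩, m, hm, hmA, -⟩ :=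
      (hX k).conservative.exists_mem_iterate_mem
        ((hAmeas i).inter hX₀meas).nullMeasurableSet (by rwa [measure_inter_conull (show μ X₀ᶜ = 0 from hX₀μ)])
    rw [smul_iterate_apply] at hmA
    obtain ⟨-, hfr, -, heq, -⟩ := hX₀ x hx0
    have h1 : F (k ^ m • x) = F x := by rw [heq, map_pow, hk, one_pow, one_smul]
    obtain ⟨h2, h3, h4⟩ := hxA
    obtain ⟨h2', h3', h4'⟩ := hmA
    simp only [Set.mem_ofPred_eq] at h2 h3 h2' h3'
    simp only [hF, h2, h2', h3, h3'] at h1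
    have h5 := f.injOn h4' h4 (MulAction.injective i.2 h1)
    exact hG k m hm (hfr _ (MulAction.injective i.1 h5))
  have hFinj : Set.InjOn F X₀ := by
    intro x hx x' hx' h
    obtain ⟨g, hg, hg1⟩ := hfiber x hx x' hx' 1 (by rwa [one_smul])
    rw [← hg, hαinj (hg1.trans (map_one α).symm), one_smul]
  have hFimg : ∀ B ⊆ X₀, MeasurableSet B →
      MeasurableSet (F '' B) ∧ ν (F '' B) = f.kappa * μ B := by
    intro B hBX hB
    have hBA : B = ⋃ i, B ∩ A i := by
      rw [← Set.inter_iUnion, eq_comm, Set.inter_eq_left]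
      exact fun x hx => Set.mem_iUnion.mpr (hX₀ x (hBX hx)).1
    have hdisj : Pairwise (Function.onFun Disjoint fun i => B ∩ A i) := by
      rintro ⟨g, h⟩ ⟨g', h'⟩ hne
      refine Set.disjoint_left.mpr ?_
      rintro x ⟨hx, h1, h2, -⟩ ⟨-, h1', h2', -⟩
      simp only [Set.mem_ofPred_eq] at h1 h2 h1' h2'
      refine hne (Prod.ext ?_ (h1.symm.trans h1'))
      refine inv_mul_eq_one.mp ((hX₀ x (hBX hx)).2.1 _ ?_)
      rw [mul_smul, ← h2', h2, inv_smul_smul]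
    have hm : ∀ i, MeasurableSet (B ∩ A i) := fun i => hB.inter (hAmeas i)
    have hi := fun i => himg i (B ∩ A i) Set.inter_subset_right (hm i)
    have himgU : F '' B = ⋃ i, F '' (B ∩ A i) := by
      rw [← Set.image_iUnion, ← hBA]
    refine ⟨himgU ▸ .iUnion fun i => (hi i).1, ?_⟩
    rw [himgU, measure_iUnion _ fun i => (hi i).1]
    · conv_rhs => rw [hBA, measure_iUnion hdisj hm, ← ENNReal.tsum_mul_left]
      exact tsum_congr fun i => (hi i).2
    · intro i j hij
      refine Set.disjoint_left.mpr ?_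
      rintro _ ⟨x, hx, rfl⟩ ⟨x', hx', hxx'⟩
      rw [hFinj (hBX hx'.1) (hBX hx.1) hxx'] at hx'
      exact Set.disjoint_left.mp (hdisj hij) hx hx'
  have hX₀1 : μ X₀ = 1 := prob_compl_eq_zero_iff hX₀meas |>.mp hX₀μ
  obtain ⟨hEmeas, hEν⟩ := hFimg X₀ subset_rfl hX₀meas
  rw [hX₀1, mul_one] at hEν
  have hκ1 : f.kappa = 1 := le_antisymm (hEν ▸ prob_le_one) hκ
  rw [hκ1] at hEν
  have hE : ∀ᵐ y ∂ν, y ∈ F '' X₀ := (prob_compl_eq_zero_iff hEmeas).mpr hEν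
  have hFmp : MeasurePreserving F μ ν := by
    refine ⟨hFmeas, Measure.ext fun B hB => ?_⟩
    rw [Measure.map_apply hFmeas hB, ← measure_inter_conull (show μ X₀ᶜ = 0 from hX₀μ),
      ← measure_inter_conull (show ν (F '' X₀)ᶜ = 0 from hE),
      ← Set.image_preimage_inter, (hFimg _ Set.inter_subset_right
        ((hFmeas hB).inter hX₀meas)).2, hκ1, one_mul]
  have hαsurj : Function.Surjective α := by
    intro h
    obtain ⟨_, ⟨x, hx, rfl⟩, x', hx', h1⟩ := (hE.and ((hY h).quasiMeasurePreserving.ae hE)).exists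
    obtain ⟨g, -, hg⟩ := hfiber x hx x' hx' h h1.symm
    exact ⟨g, hg⟩
  refine ⟨hκ1, MulEquiv.ofBijective α ⟨hαinj, hαsurj⟩, fun _ => rfl, F, ⟨hFmeas, hFmp, ?_⟩,
    ae_all_iff.mp hFequiv⟩
  have := hX₀meas.standardBorel
  have hemb : MeasurableEmbedding (X₀.domRestrict F) :=
    (hFmeas.comp measurable_subtype_coe).measurableEmbedding hFinj.injective
  obtain ⟨x₀, -⟩ := hX₀μ.exists
  obtain ⟨F', hF'meas, hF'⟩ := hemb.exists_measurable_extend measurable_subtype_coe fun _ => ⟨x₀⟩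
  have hleft : ∀ x ∈ X₀, F' (F x) = x := fun x hx => congrFun hF' ⟨x, hx⟩
  refine ⟨F', hF'meas, hX₀μ.mono hleft, ?_⟩
  filter_upwards [hE]
  rintro _ ⟨x, hx, rfl⟩
  rw [hleft x hx]

end Dynamics

/-- If an SOE cocycle (with compression at least 1) from an irreducible
action of a one-ended right-angled Artin group can be untwisted on one standard generator,
then the compression is 1, the cocycle is cohomologous to an isomorphism, and the actions
are conjugate. -/
theorem stmt18
    {V W : Type} [Fintype V] [Fintype W]
    (Γ : SimpleGraph V) (hΓconn : Γ.Connected) (hΓcard : 2 ≤ Fintype.card V)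
    (Λ : SimpleGraph W)
    (X Y : Type) [MeasurableSpace X] [MeasurableSpace Y]
    [StandardBorelSpace X] [StandardBorelSpace Y]
    (μ : Measure X) (ν : Measure Y) [IsProbabilityMeasure μ] [IsProbabilityMeasure ν]
    [MulAction (RAAG Γ) X] [MulAction (RAAG Λ) Y]
    (hXpmp : PmpAction (RAAG Γ) X μ) (hXfree : FreeAction (RAAG Γ) X μ)
    (hXerg : ErgodicAction (RAAG Γ) X μ)
    (hYpmp : PmpAction (RAAG Λ) Y ν) (hYfree : FreeAction (RAAG Λ) Y ν)
    (hYerg : ErgodicAction (RAAG Λ) Y ν)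
    (hgen_erg : ∀ v : V, Ergodic (fun x : X => gen Γ v • x) μ)
    (f : StableOE (RAAG Γ) X (RAAG Λ) Y μ ν) (hκ : 1 ≤ f.kappa)
    (c : RAAG Γ → X → RAAG Λ) (hc : f.IsSOECocycle c)
    (c' : RAAG Γ → X → RAAG Λ) (hcc' : Cohomologous (RAAG Γ) X (RAAG Λ) μ c c')
    (v : V) (h₀ : RAAG Λ) (hconst : ∀ᵐ x ∂μ, c' (gen Γ v) x = h₀) :
    f.kappa = 1 ∧ ∃ α : RAAG Γ ≃* RAAG Λ,
      Cohomologous (RAAG Γ) X (RAAG Λ) μ c (fun g _ => α g) ∧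
      ConjugateVia (RAAG Γ) X (RAAG Λ) Y μ ν α := by
  have : Countable (RAAG Γ) := (PresentedGroup.mk_surjective (raagRels Γ)).countable
  have : Countable (RAAG Λ) := (PresentedGroup.mk_surjective (raagRels Λ)).countable
  obtain ⟨φ, hφ, hφc⟩ := hcc'
  obtain ⟨α, hα⟩ := (hc.1.twist hXpmp hφ).exists_hom_of_raag (raag_rootConjugationProperty Λ)
    hΓconn hXpmp hgen_erg (v := v) ⟨h₀, by
      filter_upwards [hconst, hφc (gen Γ v)] with x h1 h2
      rw [← h1, h2, twist]⟩
  have hα' : ∀ g, ∀ᵐ x ∂μ, α g = φ (g • x) * c g x * (φ x)⁻¹ :=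
    fun g => (hα g).mono fun x hx => hx.symm
  obtain ⟨hκ1, β, hβ, hconj⟩ := f.conjugateVia_of_hom hXpmp hXfree hYpmp hYfree
    (fun _ _ hn h => raag_eq_one_of_pow_eq_one Γ hn h) hκ hc hφ α hα'
  exact ⟨hκ1, β, ⟨φ, hφ, fun g => by simpa only [hβ] using hα' g⟩, hconj⟩

end OEPaper
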